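/- arXiv:1902.10337 — 2 statements merged into one kernel-verified Lean document; each statement's English description precedes it below -/
import Mathlib

section
/- (SLH closing 2-opt type 1.) Let G be a simple graph on n ≥ 3 vertices and let L be a circle ordering of G written cyclically as L = X ++ Y, where X = (x, …, b) and Y = (a, …, y) are nonempty segments (possibly of length one, in which case x = b or a = y). Suppose {b, a} and {y, x} are gaps of L and {x, a} is an edge of G. Then the circle ordering L′ = X.reverse ++ Y = (b, …, x, a, …, y) satisfies g(L′) ≤ g(L) − 1. -/
variable {V : Type*}

/-- The adjacent pairs of a circle ordering `L`: the unordered pairs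
`{vᵢ, vᵢ₊₁}` (indices mod `L.length`). -/
def adjPairs (L : List V) : List (Sym2 V) :=
  (L.zip (L.rotate 1)).map (fun p => s(p.1, p.2))

/-- `L` is a circle ordering of the vertex set `V`: a list containing every
vertex exactly once, regarded cyclically. -/
def IsCircleOrdering [Fintype V] (L : List V) : Prop :=
  L.Nodup ∧ ∀ v : V, v ∈ L

/-- `g(L)`: the number of gaps of `L`, i.e. adjacent pairs of `L` that are
not edges of `G`. -/
noncomputable def numGaps (G : SimpleGraph V) (L : List V) : ℕ :=
  (adjPairs L).countP (fun e => @decide (e ∉ G.edgeSet) (Classical.propDecidable _))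

/-- `dist(L, H) = n - (number of adjacent pairs of `L` lying in the edge set `H`)`. -/
noncomputable def distTo (H : Set (Sym2 V)) (L : List V) : ℕ :=
  L.length - (adjPairs L).countP (fun e => @decide (e ∈ H) (Classical.propDecidable _))

/-- `Δ(L, H) = g(L)/3 + dist(L, H)`. -/
noncomputable def delta (G : SimpleGraph V) (H : Set (Sym2 V)) (L : List V) : ℚ :=
  (numGaps G L : ℚ) / 3 + (distTo H L : ℚ)

/-- Two circle orderings are equivalent iff one is obtained from the other by a
cyclic rotation, a reversal of the order, or a composition of both. -/
def OrderEquiv (L M : List V) : Prop :=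
  (∃ k, M = L.rotate k) ∨ (∃ k, M = L.reverse.rotate k)

/-- A γ-move maps an ordering `A ++ B` (with `A`, `B` nonempty) to
`A.reverse ++ B`. -/
def GammaMove (L M : List V) : Prop :=
  ∃ A B : List V, A ≠ [] ∧ B ≠ [] ∧ L = A ++ B ∧ M = A.reverse ++ B

/-- A κ-move maps an ordering `A ++ B ++ C ++ D` (with `A`, `B`, `D` nonempty,
`C` possibly empty) to `A.reverse ++ B.reverse ++ D ++ C.reverse`. -/
def KappaMove (L M : List V) : Prop :=
  ∃ A B C D : List V, A ≠ [] ∧ B ≠ [] ∧ D ≠ [] ∧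
    L = A ++ B ++ C ++ D ∧ M = A.reverse ++ B.reverse ++ D ++ C.reverse

/-- A γ-move applied up to equivalence: the ordering may first be replaced by
any equivalent ordering. -/
def GammaStep (L M : List V) : Prop := ∃ L', OrderEquiv L L' ∧ GammaMove L' M

/-- A κ-move applied up to equivalence. -/
def KappaStep (L M : List V) : Prop := ∃ L', OrderEquiv L L' ∧ KappaMove L' M

/-- `M` is obtained from `L` by applying at most one κ-move and at most one
γ-move (in some order), each up to equivalence. -/
def KGStep (L M : List V) : Prop :=
  OrderEquiv L M ∨ GammaStep L M ∨ KappaStep L M ∨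
    (∃ K, KappaStep L K ∧ GammaStep K M) ∨
    (∃ K, GammaStep L K ∧ KappaStep K M)

/-- The pairs of consecutive entries of a list, without the cyclic closing pair. -/
def pathPairs : List V → List (Sym2 V)
  | [] => []
  | [_] => []
  | u :: v :: l => s(u, v) :: pathPairs (v :: l)

theorem pathPairs_append {u v : V} :
    ∀ {A B : List V}, A.getLast? = some u → B.head? = some v →
      pathPairs (A ++ B) = pathPairs A ++ s(u, v) :: pathPairs B
  | [], _, hA, _ => by simp at hA
  | [_], [], _, hB => by simp at hB
  | [_], _ :: _, hA, hB => by
    simp only [List.getLast?_singleton, List.head?_cons, Option.some.injEq] at hA hB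
    subst hA hB
    rfl
  | _ :: w :: A, B, hA, hB => by
    have ih := pathPairs_append (A := w :: A) (by simpa using hA) hB
    simpa [pathPairs] using ih

theorem pathPairs_reverse : ∀ A : List V, pathPairs A.reverse = (pathPairs A).reverse
  | [] => rfl
  | [_] => rfl
  | u :: v :: l => by
    rw [List.reverse_cons, pathPairs_append (u := v) (v := u) (by simp) (by simp),
      pathPairs_reverse (v :: l)]
    simp [pathPairs, Sym2.eq_swap]

theorem map_zip_append_singleton (x z : V) (l : List V) :
    ((x :: l).zip (l ++ [z])).map (fun p => s(p.1, p.2)) = pathPairs (x :: l ++ [z]) := by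
  induction l generalizing x with
  | nil => rfl
  | cons w l ih => simpa [pathPairs] using ih w

theorem adjPairs_append {A B : List V} {x b a y : V}
    (hx : A.head? = some x) (hb : A.getLast? = some b)
    (ha : B.head? = some a) (hy : B.getLast? = some y) :
    adjPairs (A ++ B) = pathPairs A ++ s(b, a) :: (pathPairs B ++ [s(y, x)]) := by
  have h : adjPairs (A ++ B) = pathPairs (A ++ (B ++ [x])) := by
    obtain ⟨A', rfl⟩ := List.head?_eq_some_iff.mp hx
    simpa [adjPairs] using map_zip_append_singleton x x (A' ++ B)
  rw [h, pathPairs_append (v := a) hb (by simp [ha]), pathPairs_append hy List.head?_cons]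
  rfl

/-- SLH closing 2-opt type 1: if `{b,a}` and `{y,x}` are gaps of
`L = (x,…,b) ++ (a,…,y)` and `{x,a}` is an edge of `G`, then reversing the
first segment reduces the number of gaps by at least 1. -/
theorem stmt7 [Fintype V] (G : SimpleGraph V) (hn : 3 ≤ Fintype.card V)
    (X Y : List V) (x b a y : V)
    (hX : X ≠ []) (hY : Y ≠ [])
    (hx : X.head? = some x) (hb : X.getLast? = some b)
    (ha : Y.head? = some a) (hy : Y.getLast? = some y)
    (hL : IsCircleOrdering (X ++ Y))
    (hgap1 : s(b, a) ∉ G.edgeSet) (hgap2 : s(y, x) ∉ G.edgeSet)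
    (hedge : s(x, a) ∈ G.edgeSet) :
    numGaps G (X.reverse ++ Y) + 1 ≤ numGaps G (X ++ Y) := by
  have hrx : X.reverse.head? = some b := by rw [List.head?_reverse, hb]
  have hrb : X.reverse.getLast? = some x := by rw [List.getLast?_reverse, hx]
  unfold numGaps
  rw [adjPairs_append hx hb ha hy, adjPairs_append hrx hrb ha hy, pathPairs_reverse]
  simp only [List.countP_append, List.countP_cons, List.countP_nil, List.countP_reverse,
    decide_eq_true_eq, hgap1, hgap2, hedge, not_true_eq_false, not_false_eq_true, if_true,
    if_false]
  split_ifs <;> omega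
end

section
/- (SLH floating 5-flo.) Let G be a simple graph on n ≥ 3 vertices and let L be a circle ordering of G written cyclically as L = A ++ B ++ C ++ D ++ (d) ++ E, where A = (x, …, e), B = (c, …, a), C = (f, …, w), D = (b, …, j) and E = (h, …, y) are nonempty segments and (d) is a single vertex. Suppose {y, x} is a gap of L and {x, a}, {b, y}, {c, d} and {f, e} are edges of G. Then the circle ordering L′ = D ++ (d) ++ B ++ A ++ C ++ E = (b, …, j, d, c, …, a, x, …, e, f, …, w, h, …, y) satisfies g(L′) ≤ g(L); if moreover {w, h} is an edge of G, then g(L′) ≤ g(L) − 1. -/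
variable {V : Type*}

open Classical in
/-- The contribution of the pair `{u, v}` to a gap count: `1` for a gap, `0` for an edge. -/
noncomputable def gapIndicator (G : SimpleGraph V) (u v : V) : ℕ :=
  if s(u, v) ∈ G.edgeSet then 0 else 1

theorem gapIndicator_of_mem {G : SimpleGraph V} {u v : V} (h : s(u, v) ∈ G.edgeSet) :
    gapIndicator G u v = 0 := if_pos h

theorem gapIndicator_of_notMem {G : SimpleGraph V} {u v : V} (h : s(u, v) ∉ G.edgeSet) :
    gapIndicator G u v = 1 := if_neg h

theorem gapIndicator_le_one (G : SimpleGraph V) (u v : V) : gapIndicator G u v ≤ 1 := by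
  unfold gapIndicator
  split <;> omega

theorem gapIndicator_comm (G : SimpleGraph V) (u v : V) :
    gapIndicator G u v = gapIndicator G v u := by
  rw [gapIndicator, gapIndicator, Sym2.eq_swap]

/-- The number of gaps among the consecutive pairs of a list read as a path. -/
noncomputable def pathGaps (G : SimpleGraph V) : List V → ℕ
  | [] => 0
  | [_] => 0
  | u :: v :: l => gapIndicator G u v + pathGaps G (v :: l)

theorem pathGaps_append (G : SimpleGraph V) {A B : List V} {u v : V}
    (hu : A.getLast? = some u) (hv : B.head? = some v) :
    pathGaps G (A ++ B) = pathGaps G A + gapIndicator G u v + pathGaps G B := by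
  obtain ⟨B, rfl⟩ : ∃ B', B = v :: B' := by cases B <;> simp_all
  induction A with
  | nil => simp at hu
  | cons a A ih =>
    cases A with
    | nil =>
      obtain rfl : a = u := by simpa using hu
      simp [pathGaps]
    | cons a' A =>
      have := ih (by simpa using hu)
      simp only [List.cons_append, pathGaps] at this ⊢
      omega

theorem countP_zip_tail_append (G : SimpleGraph V) (z a : V) (t : List V) :
    (((a :: t).zip (t ++ [z])).map (fun p => s(p.1, p.2))).countP
      (fun e => @decide (e ∉ G.edgeSet) (Classical.propDecidable _)) =
      pathGaps G (a :: t ++ [z]) := by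
  induction t generalizing a with
  | nil =>
    by_cases h : s(a, z) ∈ G.edgeSet <;> simp [pathGaps, gapIndicator, h]
  | cons b t ih =>
    simp only [List.cons_append, List.zip_cons_cons, List.map_cons, List.countP_cons, pathGaps]
      at ih ⊢
    rw [ih b, gapIndicator, add_comm]
    by_cases h : s(a, b) ∈ G.edgeSet <;> simp [h]

theorem numGaps_eq_pathGaps_add (G : SimpleGraph V) {L : List V} {u v : V}
    (hu : L.head? = some u) (hv : L.getLast? = some v) :
    numGaps G L = pathGaps G L + gapIndicator G v u := by
  obtain ⟨L, rfl⟩ : ∃ L', L = u :: L' := by cases L <;> simp_all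
  have h := countP_zip_tail_append G u u L
  rw [pathGaps_append G hv (v := u) (by simp)] at h
  simpa [numGaps, adjPairs, pathGaps] using h

theorem getLast?_append_eq_some {A B : List V} {v : V} (h : B.getLast? = some v) :
    (A ++ B).getLast? = some v := by
  simp only [List.getLast?_append, h, Option.some_or]

/-- SLH floating 5-flo: for
`L = (x,…,e) ++ (c,…,a) ++ (f,…,w) ++ (b,…,j) ++ (d) ++ (h,…,y)` with gap
`{y,x}` and edges `{x,a}`, `{b,y}`, `{c,d}`, `{f,e}`, the ordering
`(b,…,j,d,c,…,a,x,…,e,f,…,w,h,…,y)` has no more gaps; if moreover `{w,h}` is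
an edge, it has at least one gap fewer. -/
theorem stmt14 [Fintype V] (G : SimpleGraph V) (hn : 3 ≤ Fintype.card V)
    (A B C D E : List V) (x e c a f w b j d h y : V)
    (hA : A ≠ []) (hB : B ≠ []) (hC : C ≠ []) (hD : D ≠ []) (hE : E ≠ [])
    (hx : A.head? = some x) (he : A.getLast? = some e)
    (hc : B.head? = some c) (ha : B.getLast? = some a)
    (hf : C.head? = some f) (hw : C.getLast? = some w)
    (hb : D.head? = some b) (hj : D.getLast? = some j)
    (hh : E.head? = some h) (hy : E.getLast? = some y)
    (hL : IsCircleOrdering (A ++ B ++ C ++ D ++ [d] ++ E))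
    (hgap : s(y, x) ∉ G.edgeSet)
    (hedge1 : s(x, a) ∈ G.edgeSet) (hedge2 : s(b, y) ∈ G.edgeSet)
    (hedge3 : s(c, d) ∈ G.edgeSet) (hedge4 : s(f, e) ∈ G.edgeSet) :
    numGaps G (D ++ [d] ++ B ++ A ++ C ++ E) ≤
        numGaps G (A ++ B ++ C ++ D ++ [d] ++ E) ∧
      (s(w, h) ∈ G.edgeSet →
        numGaps G (D ++ [d] ++ B ++ A ++ C ++ E) + 1 ≤
          numGaps G (A ++ B ++ C ++ D ++ [d] ++ E)) := by
  have old : numGaps G (A ++ B ++ C ++ D ++ [d] ++ E) =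
      pathGaps G A + gapIndicator G e c + pathGaps G B + gapIndicator G a f + pathGaps G C +
        gapIndicator G w b + pathGaps G D + gapIndicator G j d + pathGaps G [d] +
        gapIndicator G d h + pathGaps G E + gapIndicator G y x := by
    rw [numGaps_eq_pathGaps_add G (u := x) (v := y) (by simp [hx]) (getLast?_append_eq_some hy),
      pathGaps_append G (u := d) (by simp) hh,
      pathGaps_append G (u := j) (v := d) (getLast?_append_eq_some hj) rfl,
      pathGaps_append G (u := w) (getLast?_append_eq_some hw) hb,
      pathGaps_append G (u := a) (getLast?_append_eq_some ha) hf,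
      pathGaps_append G he hc]
  have new : numGaps G (D ++ [d] ++ B ++ A ++ C ++ E) =
      pathGaps G D + gapIndicator G j d + pathGaps G [d] + gapIndicator G d c + pathGaps G B +
        gapIndicator G a x + pathGaps G A + gapIndicator G e f + pathGaps G C +
        gapIndicator G w h + pathGaps G E + gapIndicator G y b := by
    rw [numGaps_eq_pathGaps_add G (u := b) (v := y) (by simp [hb]) (getLast?_append_eq_some hy),
      pathGaps_append G (u := w) (getLast?_append_eq_some hw) hh,
      pathGaps_append G (u := e) (getLast?_append_eq_some he) hf,
      pathGaps_append G (u := a) (getLast?_append_eq_some ha) hx,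
      pathGaps_append G (u := d) (by simp) hc,
      pathGaps_append G (v := d) hj rfl]
  have hyx := gapIndicator_of_notMem hgap
  have hax := (gapIndicator_comm G a x).trans (gapIndicator_of_mem hedge1)
  have hyb := (gapIndicator_comm G y b).trans (gapIndicator_of_mem hedge2)
  have hdc := (gapIndicator_comm G d c).trans (gapIndicator_of_mem hedge3)
  have hef := (gapIndicator_comm G e f).trans (gapIndicator_of_mem hedge4)
  have hwh := gapIndicator_le_one G w h
  refine ⟨by omega, fun hedge => ?_⟩
  have := gapIndicator_of_mem hedge
  omega
end
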